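/- In the limit of large chain length n, the creation operators of translationally invariant modes act on the approximate Fock vectors as bosonic creation/annihilation operators: for a pattern β, A*_β(n) |n; n⟩ = √(n_β + 1) |n + δ^β; n⟩ + o(1) and A_β(n) |n; n⟩ = √(n_β) |n − δ^β; n⟩ + o(1) in norm, where δ^β is the counts vector that is 1 at β and 0 elsewhere. -/

import Mathlib

/-- The vacuum `Ω_n = |0⟩^{⊗n}` of the spin chain, in the occupation-set representation
where a basis configuration is the (finite) set of sites carrying a `1`. -/
noncomputable def vac : Finset ℕ → ℂ := fun S => if S = ∅ then 1 else 0

/-- Sites where the pattern `α` placed at starting position `i` carries a `1`. -/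
def onesOf (α : List Bool) (i : ℕ) : Finset ℕ :=
  ((Finset.range α.length).filter fun j => α.getD j false = true).image fun j => i + j

/-- The operator `σ^α_i` (tensor product of `σ⁺ = |1⟩⟨0|` on the `1`-sites of `α` shifted
by `i`, identity elsewhere). -/
noncomputable def patOp (α : List Bool) (i : ℕ) (ψ : Finset ℕ → ℂ) : Finset ℕ → ℂ :=
  fun S => if onesOf α i ⊆ S then ψ (S \ onesOf α i) else 0

/-- Its adjoint `σ^{α*}_i` (tensor product of `σ⁻ = |0⟩⟨1|` on the `1`-sites). -/
noncomputable def patOpAdj (α : List Bool) (i : ℕ) (ψ : Finset ℕ → ℂ) : Finset ℕ → ℂ :=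
  fun S => if Disjoint (onesOf α i) S then ψ (S ∪ onesOf α i) else 0

/-- Creation operator `A*_α(n) = n^{-1/2} ∑_{i=1}^{n-|α|+1} σ^α_i`. -/
noncomputable def Astar (n : ℕ) (α : List Bool) (ψ : Finset ℕ → ℂ) : Finset ℕ → ℂ :=
  fun S => ((Real.sqrt n)⁻¹ : ℂ) *
    ∑ i ∈ Finset.range (n - α.length + 1), patOp α i ψ S

/-- Annihilation operator `A_α(n) = n^{-1/2} ∑_{i=1}^{n-|α|+1} σ^{α*}_i`. -/
noncomputable def Aann (n : ℕ) (α : List Bool) (ψ : Finset ℕ → ℂ) : Finset ℕ → ℂ :=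
  fun S => ((Real.sqrt n)⁻¹ : ℂ) *
    ∑ i ∈ Finset.range (n - α.length + 1), patOpAdj α i ψ S

/-- Approximate Fock vector `|𝐧; n⟩ = (𝐧!)^{-1/2} ∏_j A*_{α_j}(n)^{c_j} Ω_n`. -/
noncomputable def fock (n : ℕ) {p : ℕ} (α : Fin p → List Bool) (c : Fin p → ℕ) :
    Finset ℕ → ℂ :=
  fun S => ((Real.sqrt (∏ j, Nat.factorial (c j)))⁻¹ : ℂ) *
    ((List.ofFn fun j : Fin p => (Astar n (α j))^[c j]).foldr (· ∘ ·) id vac) S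

open scoped ENNReal

theorem mem_onesOf {α : List Bool} {i x : ℕ} :
    x ∈ onesOf α i ↔ i ≤ x ∧ α.getD (x - i) false = true := by
  simp only [onesOf, Finset.mem_image, Finset.mem_filter, Finset.mem_range]
  constructor
  · rintro ⟨k, ⟨-, hk⟩, rfl⟩
    simpa using hk
  · rintro ⟨hi, hx⟩
    refine ⟨x - i, ⟨?_, hx⟩, by omega⟩
    by_contra h
    rw [List.getD_eq_default _ _ (by omega)] at hx
    simp at hx

theorem lt_of_mem_onesOf {α : List Bool} {i x : ℕ} (h : x ∈ onesOf α i) :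
    i ≤ x ∧ x < i + α.length := by
  simp only [onesOf, Finset.mem_image, Finset.mem_filter, Finset.mem_range] at h
  obtain ⟨k, ⟨hk, -⟩, rfl⟩ := h
  omega

theorem card_onesOf_le (α : List Bool) (i : ℕ) : (onesOf α i).card ≤ α.length := by
  refine Finset.card_image_le.trans ((Finset.card_filter_le _ _).trans ?_)
  simp

/-- A pattern that begins and ends with a `1`. -/
def IsPattern (α : List Bool) : Prop := α.head? = some true ∧ α.getLast? = some true

theorem IsPattern.length_pos {α : List Bool} (h : IsPattern α) : 0 < α.length := by
  rcases α with _ | ⟨a, l⟩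
  · simp [IsPattern] at h
  · simp

theorem IsPattern.left_mem {α : List Bool} (h : IsPattern α) (i : ℕ) : i ∈ onesOf α i := by
  rw [mem_onesOf]
  have h1 := h.1
  rw [List.head?_eq_getElem?] at h1
  simp [List.getD_eq_getElem?_getD, h1]

theorem IsPattern.right_mem {α : List Bool} (h : IsPattern α) (i : ℕ) :
    i + (α.length - 1) ∈ onesOf α i := by
  rw [mem_onesOf]
  have h1 := h.2
  rw [List.getLast?_eq_getElem?] at h1
  simp [List.getD_eq_getElem?_getD, h1]

theorem onesOf_inj {α β : List Bool} (hα : IsPattern α) (hβ : IsPattern β) {i j : ℕ}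
    (h : onesOf α i = onesOf β j) : α = β ∧ i = j := by
  have hij : i = j := by
    have h1 := lt_of_mem_onesOf (h ▸ hα.left_mem i)
    have h2 := lt_of_mem_onesOf (h.symm ▸ hβ.left_mem j)
    omega
  subst hij
  have hlen : α.length = β.length := by
    have h1 := lt_of_mem_onesOf (h ▸ hα.right_mem i)
    have h2 := lt_of_mem_onesOf (h.symm ▸ hβ.right_mem i)
    have := hα.length_pos
    have := hβ.length_pos
    omega
  refine ⟨List.ext_getElem hlen fun k h1 h2 => ?_, rfl⟩
  have hk : i + k ∈ onesOf α i ↔ i + k ∈ onesOf β i := by rw [h]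
  simp only [mem_onesOf, Nat.le_add_right, Nat.add_sub_cancel_left, true_and,
    List.getD_eq_getElem _ _ h1, List.getD_eq_getElem _ _ h2] at hk
  exact Bool.eq_iff_iff.2 hk

theorem card_filter_not_disjoint_le (α : List Bool) (I A : Finset ℕ) :
    (I.filter fun i => ¬ Disjoint (onesOf α i) A).card ≤ A.card * α.length := by
  calc _ ≤ ((A ×ˢ Finset.range α.length).image fun y => y.1 - y.2).card := by
        refine Finset.card_le_card fun i hi => ?_
        obtain ⟨x, hx, hxA⟩ := Finset.not_disjoint_iff.1 (Finset.mem_filter.1 hi).2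
        have := lt_of_mem_onesOf hx
        exact Finset.mem_image.2 ⟨(x, x - i), Finset.mem_product.2
          ⟨hxA, Finset.mem_range.2 (by omega)⟩, by simp only; omega⟩
    _ ≤ _ := Finset.card_image_le.trans (by simp)

/-- The pairs of starting positions at which the patterns `β` and `α` overlap. -/
def overlaps (β α : List Bool) (I J : Finset ℕ) : Finset (ℕ × ℕ) :=
  (I ×ˢ J).filter fun x => ¬ Disjoint (onesOf β x.1) (onesOf α x.2)

theorem card_overlaps_le (β α : List Bool) (I J : Finset ℕ) :
    (overlaps β α I J).card ≤ I.card * (β.length * α.length) := by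
  have : overlaps β α I J ⊆ I.biUnion fun i =>
      (J.filter fun j => ¬ Disjoint (onesOf α j) (onesOf β i)).image fun j => (i, j) := by
    intro x hx
    simp only [overlaps, Finset.mem_filter, Finset.mem_product] at hx
    simp only [Finset.mem_biUnion, Finset.mem_image, Finset.mem_filter]
    exact ⟨x.1, hx.1.1, x.2, ⟨hx.1.2, fun h => hx.2 h.symm⟩, rfl⟩
  refine (Finset.card_le_card this).trans (Finset.card_biUnion_le_card_mul _ _ _ fun i _ => ?_)
  refine Finset.card_image_le.trans ((card_filter_not_disjoint_le _ _ _).trans ?_)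
  exact Nat.mul_le_mul_right _ (card_onesOf_le _ _)

theorem card_overlaps_left_le (β α : List Bool) (I J A : Finset ℕ) :
    ((overlaps β α I J).filter fun x => ¬ Disjoint (onesOf β x.1) A).card ≤
      A.card * β.length * (β.length * α.length) := by
  refine le_trans (Finset.card_le_card ?_) ((card_overlaps_le β α
    (I.filter fun i => ¬ Disjoint (onesOf β i) A) J).trans
      (Nat.mul_le_mul_right _ (card_filter_not_disjoint_le _ _ _)))
  intro x hx
  simp only [overlaps, Finset.mem_filter, Finset.mem_product] at hx ⊢
  tauto

theorem card_overlaps_right_le (β α : List Bool) (I J A : Finset ℕ) :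
    ((overlaps β α I J).filter fun x => ¬ Disjoint (onesOf α x.2) A).card ≤
      A.card * α.length * (α.length * β.length) := by
  refine le_trans ?_ (card_overlaps_left_le α β J I A)
  refine Finset.card_le_card_of_injOn Prod.swap (fun x hx => ?_) Prod.swap_injective.injOn
  simp only [overlaps, Finset.coe_filter, Set.mem_ofPred_eq, Finset.mem_filter,
    Finset.mem_product, Prod.fst_swap, Prod.snd_swap] at hx ⊢
  rw [disjoint_comm (a := onesOf α x.2) (b := onesOf β x.1)]
  tauto

/-- The squared `ℓ²` norm. -/
noncomputable def sqNorm (ψ : Finset ℕ → ℂ) : ℝ≥0∞ := ∑' S, ENNReal.ofReal (‖ψ S‖ ^ 2)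

theorem sqNorm_add_le (ψ φ : Finset ℕ → ℂ) :
    sqNorm (ψ + φ) ≤ 2 * (sqNorm ψ + sqNorm φ) := by
  rw [sqNorm, sqNorm, sqNorm, ← ENNReal.tsum_add, ← ENNReal.tsum_mul_left]
  refine ENNReal.tsum_le_tsum fun S => ?_
  have h2 : (2 : ℝ≥0∞) = ENNReal.ofReal 2 := by simp
  rw [← ENNReal.ofReal_add (by positivity) (by positivity), h2,
    ← ENNReal.ofReal_mul (by positivity)]
  refine ENNReal.ofReal_le_ofReal ?_
  have := norm_add_le (ψ S) (φ S)
  simp only [Pi.add_apply]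
  nlinarith [sq_nonneg (‖ψ S‖ - ‖φ S‖), norm_nonneg (ψ S + φ S)]

theorem sqNorm_smul (a : ℂ) (ψ : Finset ℕ → ℂ) :
    sqNorm (a • ψ) = ENNReal.ofReal (‖a‖ ^ 2) * sqNorm ψ := by
  rw [sqNorm, sqNorm, ← ENNReal.tsum_mul_left]
  refine tsum_congr fun S => ?_
  rw [← ENNReal.ofReal_mul (by positivity), Pi.smul_apply, smul_eq_mul, norm_mul, mul_pow]

open Classical in
/-- The Schur test for a sum of partial injections of configurations. -/
theorem sqNorm_sum_le {ι : Type*} (X : Finset ι) (v : ι → Finset ℕ → Prop)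
    [∀ x S, Decidable (v x S)]
    (g : ι → Finset ℕ → Finset ℕ) (ψ : Finset ℕ → ℂ) (R C K : ℕ)
    (hψ : ∀ S, ψ S ≠ 0 → S.card ≤ K)
    (hinj : ∀ x ∈ X, ∀ S S', v x S → v x S' → g x S = g x S' → S = S')
    (hR : ∀ S, (X.filter fun x => v x S ∧ (g x S).card ≤ K).card ≤ R)
    (hC : ∀ S₀ : Finset ℕ, S₀.card ≤ K →
      (X.filter fun x => ∃ S, v x S ∧ g x S = S₀).card ≤ C) :
    sqNorm (fun S => ∑ x ∈ X, if v x S then ψ (g x S) else 0) ≤ (R * C : ℕ) * sqNorm ψ := by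
  set w : Finset ℕ → ℝ≥0∞ := fun S => ENNReal.ofReal (‖ψ S‖ ^ 2) with hw
  have hpt : ∀ S, ENNReal.ofReal (‖∑ x ∈ X, if v x S then ψ (g x S) else 0‖ ^ 2) ≤
      R * ∑ x ∈ X, if v x S then w (g x S) else 0 := by
    intro S
    set Y := X.filter fun x => v x S ∧ (g x S).card ≤ K with hY
    have h1 : ∑ x ∈ X, (if v x S then ψ (g x S) else 0) = ∑ x ∈ Y, ψ (g x S) := by
      rw [hY, Finset.sum_filter]
      refine Finset.sum_congr rfl fun x _ => ?_
      by_cases hv : v x S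
      · by_cases hk : (g x S).card ≤ K
        · simp [hv, hk]
        · have : ψ (g x S) = 0 := by
            by_contra h
            exact hk (hψ _ h)
          simp [hv, this]
      · simp [hv]
    have h2 : ∑ x ∈ Y, w (g x S) ≤ ∑ x ∈ X, if v x S then w (g x S) else 0 := by
      rw [← Finset.sum_filter]
      refine Finset.sum_le_sum_of_subset fun x hx => ?_
      simp only [hY, Finset.mem_filter] at hx ⊢
      tauto
    rw [h1]
    refine le_trans ?_ (mul_le_mul_right h2 _)
    have h3 : ‖∑ x ∈ Y, ψ (g x S)‖ ^ 2 ≤ (R : ℝ) * ∑ x ∈ Y, ‖ψ (g x S)‖ ^ 2 := by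
      calc _ ≤ (∑ x ∈ Y, ‖ψ (g x S)‖) ^ 2 := by
            gcongr
            exact norm_sum_le _ _
        _ ≤ Y.card * ∑ x ∈ Y, ‖ψ (g x S)‖ ^ 2 := sq_sum_le_card_mul_sum_sq
        _ ≤ _ := by
            gcongr
            exact hR S
    refine (ENNReal.ofReal_le_ofReal h3).trans ?_
    rw [ENNReal.ofReal_mul (by positivity), ENNReal.ofReal_natCast,
      ENNReal.ofReal_sum_of_nonneg fun _ _ => by positivity]
  have hcol : ∀ x ∈ X, ∑' S, (if v x S then w (g x S) else 0) ≤
      ∑' S₀, if ∃ S, v x S ∧ g x S = S₀ then w S₀ else 0 := by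
    intro x hx
    have h1 : ∑' S, (if v x S then w (g x S) else 0) = ∑' S : {S | v x S}, w (g x S) := by
      rw [tsum_subtype {S | v x S} fun S => w (g x S)]
      exact tsum_congr fun S => by simp [Set.indicator_apply]
    have h2 : ∀ S : {S | v x S}, w (g x S) =
        (fun S₀ => if ∃ S, v x S ∧ g x S = S₀ then w S₀ else 0) (g x S) := by
      intro S
      have : ∃ S', v x S' ∧ g x S' = g x S := ⟨S, S.2, rfl⟩
      simp [this]
    rw [h1, tsum_congr h2]
    exact ENNReal.tsum_comp_le_tsum_of_injective
      (f := fun S : {S | v x S} => g x S)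
      (fun S S' h => Subtype.ext (hinj x hx _ _ S.2 S'.2 h)) _
  calc _ ≤ ∑' S, R * ∑ x ∈ X, (if v x S then w (g x S) else 0) := ENNReal.tsum_le_tsum hpt
    _ = R * ∑ x ∈ X, ∑' S, (if v x S then w (g x S) else 0) := by
        rw [ENNReal.tsum_mul_left, Summable.tsum_finsetSum fun _ _ => ENNReal.summable]
    _ ≤ R * ∑ x ∈ X, ∑' S₀, (if ∃ S, v x S ∧ g x S = S₀ then w S₀ else 0) := by
        exact mul_le_mul_right (Finset.sum_le_sum hcol) _
    _ = R * ∑' S₀, ∑ x ∈ X, (if ∃ S, v x S ∧ g x S = S₀ then w S₀ else 0) := by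
        rw [Summable.tsum_finsetSum fun _ _ => ENNReal.summable]
    _ ≤ R * ∑' S₀, C * w S₀ := by
        gcongr with S₀
        rw [← Finset.sum_filter, Finset.sum_const, nsmul_eq_mul]
        by_cases h0 : ψ S₀ = 0
        · simp [hw, h0]
        · gcongr
          exact hC S₀ (hψ _ h0)
    _ = _ := by
        rw [ENNReal.tsum_mul_left, sqNorm]
        push_cast
        ring

/-- A family of operators of norm `O(n^{-1/2})` on configurations of at most `K` ones. -/
def IsSmallOp (K : ℕ) (X : ℕ → (Finset ℕ → ℂ) → Finset ℕ → ℂ) : Prop :=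
  ∃ C : ℕ, ∀ n ≥ 1, ∀ ψ : Finset ℕ → ℂ, (∀ S, ψ S ≠ 0 → S.card ≤ K) →
    sqNorm (X n ψ) ≤ ENNReal.ofReal (C / n) * sqNorm ψ

theorem IsSmallOp.add {K : ℕ} {X Y : ℕ → (Finset ℕ → ℂ) → Finset ℕ → ℂ}
    (hX : IsSmallOp K X) (hY : IsSmallOp K Y) : IsSmallOp K fun n ψ => X n ψ + Y n ψ := by
  obtain ⟨C, hC⟩ := hX
  obtain ⟨D, hD⟩ := hY
  refine ⟨2 * (C + D), fun n hn ψ hψ => (sqNorm_add_le _ _).trans ?_⟩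
  have h2 : (2 : ℝ≥0∞) = ENNReal.ofReal 2 := by simp
  calc _ ≤ 2 * (ENNReal.ofReal (C / n) * sqNorm ψ + ENNReal.ofReal (D / n) * sqNorm ψ) := by
        gcongr
        · exact hC n hn ψ hψ
        · exact hD n hn ψ hψ
    _ = _ := by
        rw [← add_mul, ← ENNReal.ofReal_add (by positivity) (by positivity), ← mul_assoc, h2,
          ← ENNReal.ofReal_mul (by positivity)]
        congr 2
        push_cast
        ring

theorem IsSmallOp.smul {K : ℕ} {X : ℕ → (Finset ℕ → ℂ) → Finset ℕ → ℂ}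
    (hX : IsSmallOp K X) {a : ℂ} (ha : ‖a‖ ≤ 1) : IsSmallOp K fun n ψ => a • X n ψ := by
  obtain ⟨C, hC⟩ := hX
  refine ⟨C, fun n hn ψ hψ => le_trans ?_ (hC n hn ψ hψ)⟩
  rw [sqNorm_smul]
  refine mul_le_of_le_one_left zero_le ?_
  rw [ENNReal.ofReal_le_one]
  exact pow_le_one₀ (norm_nonneg _) ha

open Classical in
theorem isSmallOp_of_card {ι : Type*} (X : ℕ → Finset ι) (v : ι → Finset ℕ → Prop)
    [∀ x S, Decidable (v x S)]
    (g : ι → Finset ℕ → Finset ℕ) (K c : ℕ)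
    (hinj : ∀ x, ∀ S S', v x S → v x S' → g x S = g x S' → S = S')
    (h : ∀ n ≥ 1, ∃ R C : ℕ, R * C ≤ c * n ∧
      (∀ S, ((X n).filter fun x => v x S ∧ (g x S).card ≤ K).card ≤ R) ∧
      ∀ S₀ : Finset ℕ, S₀.card ≤ K →
        ((X n).filter fun x => ∃ S, v x S ∧ g x S = S₀).card ≤ C) :
    IsSmallOp K fun n ψ =>
      (n⁻¹ : ℂ) • fun S => ∑ x ∈ X n, if v x S then ψ (g x S) else 0 := by
  refine ⟨c, fun n hn ψ hψ => ?_⟩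
  obtain ⟨R, C, hRC, hR, hC⟩ := h n hn
  rw [sqNorm_smul]
  have hn' : (0 : ℝ) < n := by exact_mod_cast hn
  calc _ ≤ ENNReal.ofReal (‖(n⁻¹ : ℂ)‖ ^ 2) * ((c * n : ℕ) * sqNorm ψ) := by
        gcongr
        refine (sqNorm_sum_le (X n) v g ψ R C K hψ (fun x _ => hinj x) hR hC).trans ?_
        gcongr
    _ = _ := by
        rw [← mul_assoc, ← ENNReal.ofReal_natCast, ← ENNReal.ofReal_mul (by positivity)]
        congr 2
        rw [norm_inv, Complex.norm_natCast]
        push_cast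
        field_simp

theorem patOpAdj_patOp (α β : List Bool) (i j : ℕ) (ψ : Finset ℕ → ℂ) (S : Finset ℕ) :
    patOpAdj β i (patOp α j ψ) S =
      if Disjoint (onesOf β i) S ∧ onesOf α j ⊆ S ∪ onesOf β i then
        ψ ((S ∪ onesOf β i) \ onesOf α j) else 0 := by
  simp only [patOpAdj, patOp, ite_and]

theorem patOp_patOpAdj (α β : List Bool) (i j : ℕ) (ψ : Finset ℕ → ℂ) (S : Finset ℕ) :
    patOp α j (patOpAdj β i ψ) S =
      if onesOf α j ⊆ S ∧ Disjoint (onesOf β i) (S \ onesOf α j) then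
        ψ (S \ onesOf α j ∪ onesOf β i) else 0 := by
  simp only [patOpAdj, patOp, ite_and]

theorem patOp_comm (α β : List Bool) (i j : ℕ) (ψ : Finset ℕ → ℂ) :
    patOp α i (patOp β j ψ) = patOp β j (patOp α i ψ) := by
  funext S
  simp only [patOp, ← ite_and]
  have h : (onesOf α i ⊆ S ∧ onesOf β j ⊆ S \ onesOf α i) ↔
      (onesOf β j ⊆ S ∧ onesOf α i ⊆ S \ onesOf β j) := by
    simp only [Finset.subset_sdiff]
    rw [disjoint_comm (a := onesOf β j)]
    tauto
  simp only [h, sdiff_sdiff_comm]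

theorem patOpAdj_patOp_comm_of_disjoint {α β : List Bool} {i j : ℕ}
    (hd : Disjoint (onesOf β i) (onesOf α j)) (ψ : Finset ℕ → ℂ) :
    patOpAdj β i (patOp α j ψ) = patOp α j (patOpAdj β i ψ) := by
  funext S
  rw [patOpAdj_patOp, patOp_patOpAdj]
  have h1 : (Disjoint (onesOf β i) S ∧ onesOf α j ⊆ S ∪ onesOf β i) ↔
      (onesOf α j ⊆ S ∧ Disjoint (onesOf β i) (S \ onesOf α j)) := by
    simp only [Finset.disjoint_left, Finset.subset_iff, Finset.mem_union, Finset.mem_sdiff] at *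
    grind
  have h2 : (S ∪ onesOf β i) \ onesOf α j = S \ onesOf α j ∪ onesOf β i := by
    rw [Finset.union_sdiff_distrib, Finset.sdiff_eq_self_of_disjoint hd]
  simp only [h1, h2]

theorem eq_of_union_sdiff_eq {T T' S₁ S₂ : Finset ℕ} (h₁ : Disjoint T S₁) (h₂ : Disjoint T S₂)
    (h₁' : T' ⊆ S₁ ∪ T) (h₂' : T' ⊆ S₂ ∪ T) (h : (S₁ ∪ T) \ T' = (S₂ ∪ T) \ T') :
    S₁ = S₂ := by
  have h3 : S₁ ∪ T = S₂ ∪ T := by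
    rw [← Finset.sdiff_union_of_subset h₁', h, Finset.sdiff_union_of_subset h₂']
  rw [← Finset.union_sdiff_cancel_right h₁.symm, h3, Finset.union_sdiff_cancel_right h₂.symm]

theorem eq_of_sdiff_union_eq {T T' S₁ S₂ : Finset ℕ} (h₁ : Disjoint T (S₁ \ T'))
    (h₂ : Disjoint T (S₂ \ T')) (h₁' : T' ⊆ S₁) (h₂' : T' ⊆ S₂)
    (h : S₁ \ T' ∪ T = S₂ \ T' ∪ T) : S₁ = S₂ := by
  have h3 : S₁ \ T' = S₂ \ T' := by
    rw [← Finset.union_sdiff_cancel_right h₁.symm, h, Finset.union_sdiff_cancel_right h₂.symm]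
  rw [← Finset.sdiff_union_of_subset h₁', h3, Finset.sdiff_union_of_subset h₂']

/-- The starting positions of the pattern `α` in a chain of length `n`. -/
abbrev starts (n : ℕ) (α : List Bool) : Finset ℕ := Finset.range (n - α.length + 1)

theorem card_starts_le {n : ℕ} (hn : 1 ≤ n) {α : List Bool} (hα : IsPattern α) :
    (starts n α).card ≤ n := by
  have := hα.length_pos
  rw [Finset.card_range]
  omega

theorem card_overlaps_starts_le {n : ℕ} (hn : 1 ≤ n) {α β : List Bool} (hβ : IsPattern β) :
    (overlaps β α (starts n β) (starts n α)).card ≤ n * (β.length * α.length) :=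
  (card_overlaps_le _ _ _ _).trans (Nat.mul_le_mul_right _ (card_starts_le hn hβ))

theorem isSmallOp_patOp_patOpAdj {α β : List Bool} (hα : IsPattern α) (hβ : IsPattern β)
    (K : ℕ) : IsSmallOp K fun n ψ => (n⁻¹ : ℂ) • fun S =>
      ∑ x ∈ overlaps β α (starts n β) (starts n α), patOp α x.2 (patOpAdj β x.1 ψ) S := by
  simp only [patOp_patOpAdj]
  apply isSmallOp_of_card (fun n => overlaps β α (starts n β) (starts n α))
    (fun x S => onesOf α x.2 ⊆ S ∧ Disjoint (onesOf β x.1) (S \ onesOf α x.2))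
    (fun x S => S \ onesOf α x.2 ∪ onesOf β x.1) K
    ((K + α.length) * α.length * (α.length * β.length) * (β.length * α.length))
  · exact fun x S S' h h' hg => eq_of_sdiff_union_eq h.2 h'.2 h.1 h'.1 hg
  intro n hn
  refine ⟨(K + α.length) * α.length * (α.length * β.length), n * (β.length * α.length),
    ?_, fun S => ?_, fun S₀ _ => ?_⟩
  · apply le_of_eq
    ring
  · by_cases hS : S.card ≤ K + α.length
    · refine le_trans (Finset.card_le_card ?_) ((card_overlaps_right_le β α (starts n β)
        (starts n α) S).trans (Nat.mul_le_mul_right _ (Nat.mul_le_mul_right _ hS)))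
      intro x hx
      rw [Finset.mem_filter] at hx ⊢
      exact ⟨hx.1, Finset.not_disjoint_iff.2
        ⟨x.2, hα.left_mem _, hx.2.1.1 (hα.left_mem _)⟩⟩
    · rw [Finset.filter_false_of_mem, Finset.card_empty]
      · exact Nat.zero_le _
      rintro x - ⟨⟨h1, h2⟩, h3⟩
      rw [Finset.card_union_of_disjoint h2.symm, Finset.card_sdiff_of_subset h1] at h3
      have := card_onesOf_le α x.2
      omega
  · classical
    exact (Finset.card_le_card (Finset.filter_subset _ _)).trans
      (card_overlaps_starts_le hn hβ)

theorem isSmallOp_patOpAdj_patOp_of_not_subset {α β : List Bool} (hβ : IsPattern β)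
    (K : ℕ) : IsSmallOp K fun n ψ => (n⁻¹ : ℂ) • fun S =>
      ∑ x ∈ (overlaps β α (starts n β) (starts n α)).filter
        (fun x => ¬ onesOf α x.2 ⊆ onesOf β x.1), patOpAdj β x.1 (patOp α x.2 ψ) S := by
  simp only [patOpAdj_patOp]
  apply isSmallOp_of_card (fun n => (overlaps β α (starts n β) (starts n α)).filter
      fun x => ¬ onesOf α x.2 ⊆ onesOf β x.1)
    (fun x S => Disjoint (onesOf β x.1) S ∧ onesOf α x.2 ⊆ S ∪ onesOf β x.1)
    (fun x S => (S ∪ onesOf β x.1) \ onesOf α x.2) K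
    ((K + α.length) * α.length * (α.length * β.length) * (β.length * α.length))
  · exact fun x S S' h h' hg => eq_of_union_sdiff_eq h.1 h'.1 h.2 h'.2 hg
  intro n hn
  refine ⟨(K + α.length) * α.length * (α.length * β.length), n * (β.length * α.length),
    ?_, fun S => ?_, fun S₀ _ => ?_⟩
  · apply le_of_eq
    ring
  · by_cases hS : S.card ≤ K + α.length
    · refine le_trans (Finset.card_le_card ?_) ((card_overlaps_right_le β α (starts n β)
        (starts n α) S).trans (Nat.mul_le_mul_right _ (Nat.mul_le_mul_right _ hS)))
      intro x hx
      rw [Finset.mem_filter, Finset.mem_filter] at hx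
      obtain ⟨y, hy, hy'⟩ := Finset.not_subset.1 hx.1.2
      rw [Finset.mem_filter]
      exact ⟨hx.1.1, Finset.not_disjoint_iff.2
        ⟨y, hy, (Finset.mem_union.1 (hx.2.1.2 hy)).resolve_right hy'⟩⟩
    · rw [Finset.filter_false_of_mem, Finset.card_empty]
      · exact Nat.zero_le _
      rintro x - ⟨⟨h1, h2⟩, h3⟩
      rw [Finset.card_sdiff_of_subset h2, Finset.card_union_of_disjoint h1.symm] at h3
      have := card_onesOf_le α x.2
      omega
  · classical
    exact (Finset.card_le_card (Finset.filter_subset _ _)).trans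
      ((Finset.card_le_card (Finset.filter_subset _ _)).trans (card_overlaps_starts_le hn hβ))

theorem isSmallOp_patOpAdj_patOp_of_ssubset {α β : List Bool} (hβ : IsPattern β)
    (K : ℕ) : IsSmallOp K fun n ψ => (n⁻¹ : ℂ) • fun S =>
      ∑ x ∈ (overlaps β α (starts n β) (starts n α)).filter
        (fun x => onesOf α x.2 ⊂ onesOf β x.1), patOpAdj β x.1 (patOp α x.2 ψ) S := by
  simp only [patOpAdj_patOp]
  apply isSmallOp_of_card (fun n => (overlaps β α (starts n β) (starts n α)).filter
      fun x => onesOf α x.2 ⊂ onesOf β x.1)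
    (fun x S => Disjoint (onesOf β x.1) S ∧ onesOf α x.2 ⊆ S ∪ onesOf β x.1)
    (fun x S => (S ∪ onesOf β x.1) \ onesOf α x.2) K
    (β.length * α.length * (K * β.length * (β.length * α.length)))
  · exact fun x S S' h h' hg => eq_of_union_sdiff_eq h.1 h'.1 h.2 h'.2 hg
  intro n hn
  refine ⟨n * (β.length * α.length), K * β.length * (β.length * α.length),
    ?_, fun S => ?_, fun S₀ hS₀ => ?_⟩
  · apply le_of_eq
    ring
  · classical
    exact (Finset.card_le_card (Finset.filter_subset _ _)).trans
      ((Finset.card_le_card (Finset.filter_subset _ _)).trans (card_overlaps_starts_le hn hβ))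
  · classical
    refine le_trans (Finset.card_le_card ?_) ((card_overlaps_left_le β α (starts n β)
      (starts n α) S₀).trans (Nat.mul_le_mul_right _ (Nat.mul_le_mul_right _ hS₀)))
    intro x hx
    rw [Finset.mem_filter, Finset.mem_filter] at hx
    obtain ⟨⟨hx, hs⟩, S, hS, rfl⟩ := hx
    obtain ⟨y, hy, hy'⟩ := Finset.exists_of_ssubset hs
    rw [Finset.mem_filter]
    exact ⟨hx, Finset.not_disjoint_iff.2
      ⟨y, hy, Finset.mem_sdiff.2 ⟨Finset.mem_union_right _ hy, hy'⟩⟩⟩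

theorem isSmallOp_not_disjoint {α : List Bool} (hα : IsPattern α) (K : ℕ) :
    IsSmallOp K fun n ψ => (n⁻¹ : ℂ) • fun S =>
      ∑ i ∈ starts n α, if ¬ Disjoint (onesOf α i) S then ψ S else 0 := by
  apply isSmallOp_of_card (fun n => starts n α) (fun i S => ¬ Disjoint (onesOf α i) S)
    (fun _ S => S) K (K * α.length)
  · exact fun _ _ _ _ _ h => h
  intro n hn
  refine ⟨K * α.length, n, le_rfl, fun S => ?_, fun S₀ _ => ?_⟩
  · by_cases hS : S.card ≤ K
    · refine le_trans (Finset.card_le_card ?_)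
        ((card_filter_not_disjoint_le α (starts n α) S).trans (Nat.mul_le_mul_right _ hS))
      intro i hi
      rw [Finset.mem_filter] at hi ⊢
      exact ⟨hi.1, hi.2.1⟩
    · rw [Finset.filter_false_of_mem fun x _ h => hS h.2, Finset.card_empty]
      exact Nat.zero_le _
  · classical
    exact (Finset.card_le_card (Finset.filter_subset _ _)).trans (card_starts_le hn hα)

theorem isSmallOp_card_starts_sub_one {α : List Bool} (hα : IsPattern α) (K : ℕ) :
    IsSmallOp K fun n ψ => ((starts n α).card / n - 1 : ℂ) • ψ := by
  refine ⟨α.length, fun n hn ψ _ => ?_⟩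
  rw [sqNorm_smul]
  gcongr
  have hn' : (0 : ℝ) < n := by exact_mod_cast hn
  have h1 : ((starts n α).card / n - 1 : ℂ) = (((starts n α).card / n - 1 : ℝ) : ℂ) := by
    push_cast
    rfl
  rw [h1, Complex.norm_real, Real.norm_eq_abs, sq_abs]
  have h2 : ((starts n α).card : ℝ) ≤ n := by exact_mod_cast card_starts_le hn hα
  have h3 : (n : ℝ) ≤ (starts n α).card + α.length := by
    have : n ≤ (starts n α).card + α.length := by rw [Finset.card_range]; omega
    exact_mod_cast this
  have h4 : ((starts n α).card / n - 1 : ℝ) ≤ 0 := by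
    rw [sub_nonpos, div_le_one hn']
    exact h2
  have h5 : -(α.length / n : ℝ) ≤ (starts n α).card / n - 1 := by
    rw [neg_le_iff_add_nonneg, sub_add_eq_add_sub, ← add_div, sub_nonneg, one_le_div hn']
    exact h3
  have h6 : (-1 : ℝ) ≤ (starts n α).card / n - 1 := by
    have : (0 : ℝ) ≤ (starts n α).card / n := by positivity
    linarith
  nlinarith

theorem Astar_sub (n : ℕ) (α : List Bool) (ψ φ : Finset ℕ → ℂ) :
    Astar n α (ψ - φ) = Astar n α ψ - Astar n α φ := by
  funext S
  simp only [Astar, Pi.sub_apply, ← mul_sub, ← Finset.sum_sub_distrib]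
  congr 1
  refine Finset.sum_congr rfl fun i _ => ?_
  simp only [patOp]
  split_ifs <;> simp

theorem Astar_smul (n : ℕ) (α : List Bool) (a : ℂ) (ψ : Finset ℕ → ℂ) :
    Astar n α (a • ψ) = a • Astar n α ψ := by
  funext S
  simp only [Astar, Pi.smul_apply, smul_eq_mul]
  rw [mul_left_comm, Finset.mul_sum (a := a)]
  congr 1
  refine Finset.sum_congr rfl fun i _ => ?_
  simp only [patOp]
  split_ifs <;> simp

theorem Aann_smul (n : ℕ) (α : List Bool) (a : ℂ) (ψ : Finset ℕ → ℂ) :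
    Aann n α (a • ψ) = a • Aann n α ψ := by
  funext S
  simp only [Aann, Pi.smul_apply, smul_eq_mul]
  rw [mul_left_comm, Finset.mul_sum (a := a)]
  congr 1
  refine Finset.sum_congr rfl fun i _ => ?_
  simp only [patOpAdj]
  split_ifs <;> simp

theorem inv_sqrt_mul_inv_sqrt (n : ℕ) :
    ((Real.sqrt n)⁻¹ : ℂ) * ((Real.sqrt n)⁻¹ : ℂ) = (n⁻¹ : ℂ) := by
  rw [← mul_inv, ← Complex.ofReal_mul, Real.mul_self_sqrt (Nat.cast_nonneg n),
    Complex.ofReal_natCast]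

theorem patOp_Astar (n : ℕ) (α β : List Bool) (j : ℕ) (ψ : Finset ℕ → ℂ) (S : Finset ℕ) :
    patOp β j (Astar n α ψ) S =
      ((Real.sqrt n)⁻¹ : ℂ) * ∑ i ∈ starts n α, patOp β j (patOp α i ψ) S := by
  simp only [patOp, Astar]
  split_ifs <;> simp

theorem patOpAdj_Astar (n : ℕ) (α β : List Bool) (j : ℕ) (ψ : Finset ℕ → ℂ) (S : Finset ℕ) :
    patOpAdj β j (Astar n α ψ) S =
      ((Real.sqrt n)⁻¹ : ℂ) * ∑ i ∈ starts n α, patOpAdj β j (patOp α i ψ) S := by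
  simp only [patOpAdj, Astar]
  split_ifs <;> simp

theorem patOp_Aann (n : ℕ) (α β : List Bool) (j : ℕ) (ψ : Finset ℕ → ℂ) (S : Finset ℕ) :
    patOp β j (Aann n α ψ) S =
      ((Real.sqrt n)⁻¹ : ℂ) * ∑ i ∈ starts n α, patOp β j (patOpAdj α i ψ) S := by
  simp only [patOp, Aann]
  split_ifs <;> simp

theorem Astar_comm (n : ℕ) (α β : List Bool) (ψ : Finset ℕ → ℂ) :
    Astar n α (Astar n β ψ) = Astar n β (Astar n α ψ) := by
  funext S
  rw [Astar, Astar]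
  congr 1
  simp only [patOp_Astar, ← Finset.mul_sum]
  rw [Finset.sum_comm]
  simp only [patOp_comm α β]

theorem Aann_Astar (n : ℕ) (α β : List Bool) (ψ : Finset ℕ → ℂ) :
    Aann n β (Astar n α ψ) = (n⁻¹ : ℂ) • fun S =>
      ∑ x ∈ starts n β ×ˢ starts n α, patOpAdj β x.1 (patOp α x.2 ψ) S := by
  funext S
  rw [Aann, Pi.smul_apply, smul_eq_mul, ← inv_sqrt_mul_inv_sqrt, mul_assoc,
    Finset.sum_product]
  simp only [patOpAdj_Astar, ← Finset.mul_sum]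

theorem Astar_Aann (n : ℕ) (α β : List Bool) (ψ : Finset ℕ → ℂ) :
    Astar n α (Aann n β ψ) = (n⁻¹ : ℂ) • fun S =>
      ∑ x ∈ starts n β ×ˢ starts n α, patOp α x.2 (patOpAdj β x.1 ψ) S := by
  funext S
  rw [Astar, Pi.smul_apply, smul_eq_mul, ← inv_sqrt_mul_inv_sqrt, mul_assoc,
    Finset.sum_product_right]
  simp only [patOp_Aann, ← Finset.mul_sum]

theorem commutator_eq (n : ℕ) (α β : List Bool) (ψ : Finset ℕ → ℂ) :
    Aann n β (Astar n α ψ) - Astar n α (Aann n β ψ) =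
      ((n⁻¹ : ℂ) • fun S => ∑ x ∈ (overlaps β α (starts n β) (starts n α)).filter
        (fun x => ¬ onesOf α x.2 ⊆ onesOf β x.1), patOpAdj β x.1 (patOp α x.2 ψ) S) +
      ((n⁻¹ : ℂ) • fun S => ∑ x ∈ (overlaps β α (starts n β) (starts n α)).filter
        (fun x => onesOf α x.2 ⊂ onesOf β x.1), patOpAdj β x.1 (patOp α x.2 ψ) S) +
      (-1 : ℂ) • ((n⁻¹ : ℂ) • fun S => ∑ x ∈ overlaps β α (starts n β) (starts n α),
        patOp α x.2 (patOpAdj β x.1 ψ) S) +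
      ((n⁻¹ : ℂ) • fun S => ∑ x ∈ (overlaps β α (starts n β) (starts n α)).filter
        (fun x => onesOf β x.1 = onesOf α x.2), patOpAdj β x.1 (patOp α x.2 ψ) S) := by
  rw [Aann_Astar, Astar_Aann]
  funext S
  simp only [Pi.add_apply, Pi.sub_apply, Pi.smul_apply, smul_eq_mul]
  have h : ∑ x ∈ starts n β ×ˢ starts n α, (patOpAdj β x.1 (patOp α x.2 ψ) S -
      patOp α x.2 (patOpAdj β x.1 ψ) S) =
      ∑ x ∈ overlaps β α (starts n β) (starts n α), (patOpAdj β x.1 (patOp α x.2 ψ) S -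
        patOp α x.2 (patOpAdj β x.1 ψ) S) := by
    rw [overlaps, Finset.sum_filter]
    refine Finset.sum_congr rfl fun x _ => ?_
    split_ifs with hd
    · rw [patOpAdj_patOp_comm_of_disjoint hd, sub_self]
    · rfl
  have h' : ∑ x ∈ overlaps β α (starts n β) (starts n α), patOpAdj β x.1 (patOp α x.2 ψ) S =
      ∑ x ∈ (overlaps β α (starts n β) (starts n α)).filter
        (fun x => ¬ onesOf α x.2 ⊆ onesOf β x.1), patOpAdj β x.1 (patOp α x.2 ψ) S +
      ∑ x ∈ (overlaps β α (starts n β) (starts n α)).filter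
        (fun x => onesOf α x.2 ⊂ onesOf β x.1), patOpAdj β x.1 (patOp α x.2 ψ) S +
      ∑ x ∈ (overlaps β α (starts n β) (starts n α)).filter
        (fun x => onesOf β x.1 = onesOf α x.2), patOpAdj β x.1 (patOp α x.2 ψ) S := by
    simp only [Finset.sum_filter, ← Finset.sum_add_distrib]
    refine Finset.sum_congr rfl fun x _ => ?_
    by_cases h1 : onesOf α x.2 ⊆ onesOf β x.1
    · by_cases h2 : onesOf β x.1 = onesOf α x.2
      · simp [h2]
      · have h3 : onesOf α x.2 ⊂ onesOf β x.1 :=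
          Finset.ssubset_iff_subset_ne.2 ⟨h1, fun h => h2 h.symm⟩
        simp [h1, h2, h3]
    · have h2 : onesOf β x.1 ≠ onesOf α x.2 := fun h => h1 h.ge
      have h3 : ¬ onesOf α x.2 ⊂ onesOf β x.1 := fun h => h1 h.1
      simp [h1, h2, h3]
  rw [Finset.sum_sub_distrib, Finset.sum_sub_distrib, h'] at h
  linear_combination (n⁻¹ : ℂ) * h

theorem sum_filter_onesOf_eq {n : ℕ} {α : List Bool} (hα : IsPattern α)
    (ψ : Finset ℕ → ℂ) (S : Finset ℕ) :
    ∑ x ∈ (overlaps α α (starts n α) (starts n α)).filter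
        (fun x => onesOf α x.1 = onesOf α x.2), patOpAdj α x.1 (patOp α x.2 ψ) S =
      (starts n α).card * ψ S -
        ∑ i ∈ starts n α, if ¬ Disjoint (onesOf α i) S then ψ S else 0 := by
  have h : (overlaps α α (starts n α) (starts n α)).filter
      (fun x => onesOf α x.1 = onesOf α x.2) = (starts n α).image fun i => (i, i) := by
    ext ⟨i, j⟩
    simp only [overlaps, Finset.mem_filter, Finset.mem_product, Finset.mem_image,
      Prod.mk.injEq]
    constructor
    · rintro ⟨⟨⟨hi, -⟩, -⟩, h⟩
      exact ⟨i, hi, rfl, (onesOf_inj hα hα h).2⟩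
    · rintro ⟨k, hk, rfl, rfl⟩
      exact ⟨⟨⟨hk, hk⟩, Finset.not_disjoint_iff.2
        ⟨k, hα.left_mem k, hα.left_mem k⟩⟩, rfl⟩
  rw [h, Finset.sum_image fun i _ j _ hij => (Prod.mk.inj hij).1, ← nsmul_eq_mul,
    ← Finset.sum_const, ← Finset.sum_sub_distrib]
  refine Finset.sum_congr rfl fun i _ => ?_
  rw [patOpAdj_patOp]
  by_cases hd : Disjoint (onesOf α i) S
  · simp [hd, Finset.union_sdiff_cancel_right hd.symm]
  · simp [hd]

theorem isSmallOp_commutator {α β : List Bool} (hα : IsPattern α) (hβ : IsPattern β) (K : ℕ) :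
    IsSmallOp K fun n ψ => Aann n β (Astar n α ψ) - Astar n α (Aann n β ψ) -
      if β = α then ψ else 0 := by
  have h := ((isSmallOp_patOpAdj_patOp_of_not_subset (α := α) hβ K).add
    (isSmallOp_patOpAdj_patOp_of_ssubset (α := α) hβ K)).add
    ((isSmallOp_patOp_patOpAdj hα hβ K).smul (a := -1) (by simp))
  simp only [commutator_eq]
  by_cases hαβ : β = α
  · subst hαβ
    convert (h.add (isSmallOp_card_starts_sub_one hβ K)).add
      ((isSmallOp_not_disjoint hβ K).smul (a := -1) (by simp)) using 3 with n ψ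
    funext S
    simp only [Pi.add_apply, Pi.sub_apply, Pi.smul_apply, smul_eq_mul, if_true,
      sum_filter_onesOf_eq hβ]
    ring
  · convert h using 3 with n ψ
    rw [Finset.filter_false_of_mem (p := fun x : ℕ × ℕ => onesOf β x.1 = onesOf α x.2)
      fun x _ hx => hαβ (onesOf_inj hβ hα hx).1, if_neg hαβ]
    funext S
    simp

theorem sqNorm_Astar_le {n : ℕ} (hn : 1 ≤ n) {α : List Bool} (hα : IsPattern α) {K : ℕ}
    {ψ : Finset ℕ → ℂ} (hψ : ∀ S, ψ S ≠ 0 → S.card ≤ K) :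
    sqNorm (Astar n α ψ) ≤ ((K + α.length) * α.length : ℕ) * sqNorm ψ := by
  have h1 : Astar n α ψ = ((Real.sqrt n)⁻¹ : ℂ) • fun S =>
      ∑ i ∈ starts n α, if onesOf α i ⊆ S then ψ (S \ onesOf α i) else 0 := rfl
  have h2 := sqNorm_sum_le (starts n α) (fun i S => onesOf α i ⊆ S)
    (fun i S => S \ onesOf α i) ψ ((K + α.length) * α.length) n K hψ
    (fun i _ S S' h h' hg => by
      rw [← Finset.sdiff_union_of_subset h, hg, Finset.sdiff_union_of_subset h'])
    (fun S => ?_) (fun S₀ _ => ?_)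
  · rw [h1, sqNorm_smul]
    refine (mul_le_mul_right h2 _).trans (le_of_eq ?_)
    rw [← mul_assoc, ← ENNReal.ofReal_natCast, ← ENNReal.ofReal_natCast,
      ← ENNReal.ofReal_mul (by positivity)]
    congr 2
    have hn' : (0 : ℝ) < n := by exact_mod_cast hn
    rw [norm_inv, Complex.norm_real, Real.norm_eq_abs, inv_pow, sq_abs,
      Real.sq_sqrt hn'.le]
    push_cast
    field_simp
  · by_cases hS : S.card ≤ K + α.length
    · refine le_trans (Finset.card_le_card ?_)
        ((card_filter_not_disjoint_le α (starts n α) S).trans (Nat.mul_le_mul_right _ hS))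
      intro i hi
      rw [Finset.mem_filter] at hi ⊢
      exact ⟨hi.1, Finset.not_disjoint_iff.2 ⟨i, hα.left_mem i, hi.2.1 (hα.left_mem i)⟩⟩
    · rw [Finset.filter_false_of_mem, Finset.card_empty]
      · exact Nat.zero_le _
      rintro i - ⟨h3, h4⟩
      rw [Finset.card_sdiff_of_subset h3] at h4
      have := card_onesOf_le α i
      omega
  · classical
    exact (Finset.card_le_card (Finset.filter_subset _ _)).trans (card_starts_le hn hα)

theorem card_le_of_Astar_ne_zero {n : ℕ} {α : List Bool} {K : ℕ} {ψ : Finset ℕ → ℂ}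
    (hψ : ∀ S, ψ S ≠ 0 → S.card ≤ K) (S : Finset ℕ) (hS : Astar n α ψ S ≠ 0) :
    S.card ≤ K + α.length := by
  obtain ⟨i, -, hi⟩ := Finset.exists_ne_zero_of_sum_ne_zero (right_ne_zero_of_mul hS)
  simp only [patOp, ne_eq, ite_eq_right_iff, Classical.not_imp] at hi
  have h1 := hψ _ hi.2
  rw [Finset.card_sdiff_of_subset hi.1] at h1
  have := card_onesOf_le α i
  omega

theorem card_le_of_Aann_ne_zero {n : ℕ} {α : List Bool} {K : ℕ} {ψ : Finset ℕ → ℂ}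
    (hψ : ∀ S, ψ S ≠ 0 → S.card ≤ K) (S : Finset ℕ) (hS : Aann n α ψ S ≠ 0) :
    S.card ≤ K := by
  obtain ⟨i, -, hi⟩ := Finset.exists_ne_zero_of_sum_ne_zero (right_ne_zero_of_mul hS)
  simp only [patOpAdj, ne_eq, ite_eq_right_iff, Classical.not_imp] at hi
  exact (Finset.card_le_card Finset.subset_union_left).trans (hψ _ hi.2)

theorem Aann_vac {α : List Bool} (hα : IsPattern α) (n : ℕ) : Aann n α vac = 0 := by
  funext S
  rw [Aann, Finset.sum_eq_zero, mul_zero, Pi.zero_apply]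
  intro i _
  have : (S ∪ onesOf α i) ≠ ∅ :=
    Finset.Nonempty.ne_empty ⟨i, Finset.mem_union_right _ (hα.left_mem i)⟩
  simp [patOpAdj, vac, this]

theorem sqNorm_zero : sqNorm 0 = 0 := by
  simp [sqNorm]

theorem sqNorm_vac : sqNorm vac = 1 := by
  rw [sqNorm, tsum_eq_single ∅ fun S hS => by simp [vac, hS]]
  simp [vac]

theorem foldr_ofFn_iterate_zero {X : Type*} :
    ∀ {p : ℕ} (f : Fin p → X → X),
      (List.ofFn fun j => (f j)^[0]).foldr (· ∘ ·) id = id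
  | 0, _ => by simp
  | p + 1, f => by
    rw [List.ofFn_succ, List.foldr_cons, foldr_ofFn_iterate_zero fun j => f j.succ]
    rfl

theorem foldr_ofFn_iterate_update_succ {X : Type*} :
    ∀ {p : ℕ} (f : Fin p → X → X) (_ : ∀ i j, Function.Commute (f i) (f j))
      (c : Fin p → ℕ) (k : Fin p) (x : X),
      (List.ofFn fun j => (f j)^[Function.update c k (c k + 1) j]).foldr (· ∘ ·) id x =
        f k ((List.ofFn fun j => (f j)^[c j]).foldr (· ∘ ·) id x)
  | 0, _, _, _, k, _ => k.elim0
  | p + 1, f, hf, c, k, x => by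
    simp only [List.ofFn_succ, List.foldr_cons, Function.comp_apply]
    induction k using Fin.cases with
    | zero =>
      simp [Function.update_of_ne, Fin.succ_ne_zero, Function.iterate_succ_apply']
    | succ k =>
      have ih := foldr_ofFn_iterate_update_succ (fun j => f j.succ)
        (fun i j => hf i.succ j.succ) (fun j => c j.succ) k x
      have h : ∀ j : Fin p, Function.update c k.succ (c k.succ + 1) j.succ =
          Function.update (fun j : Fin p => c j.succ) k (c k.succ + 1) j := by
        intro j
        simp [Function.update_apply]
      simp only [h, Function.update_of_ne (Fin.succ_ne_zero k).symm]
      rw [ih]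
      exact (((hf k.succ 0).iterate_right (c 0)) _).symm

/-- The unnormalized approximate Fock vector. -/
noncomputable def fockProd (n : ℕ) {p : ℕ} (α : Fin p → List Bool) (c : Fin p → ℕ) :
    Finset ℕ → ℂ :=
  (List.ofFn fun j : Fin p => (Astar n (α j))^[c j]).foldr (· ∘ ·) id vac

theorem fockProd_zero (n : ℕ) {p : ℕ} (α : Fin p → List Bool) : fockProd n α 0 = vac :=
  congrFun (foldr_ofFn_iterate_zero _) vac

theorem fockProd_update_succ (n : ℕ) {p : ℕ} (α : Fin p → List Bool) (c : Fin p → ℕ)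
    (k : Fin p) :
    fockProd n α (Function.update c k (c k + 1)) = Astar n (α k) (fockProd n α c) :=
  foldr_ofFn_iterate_update_succ _ (fun _ _ => Astar_comm n _ _) c k vac

theorem update_succ_induction {p : ℕ} {P : (Fin p → ℕ) → Prop} (h0 : P 0)
    (hs : ∀ c k, P c → P (Function.update c k (c k + 1))) (c : Fin p → ℕ) : P c := by
  obtain ⟨m, hm⟩ : ∃ m, ∑ j, c j = m := ⟨_, rfl⟩
  induction m generalizing c with
  | zero =>
    have : c = 0 := funext fun j => Finset.sum_eq_zero_iff.1 hm j (Finset.mem_univ j)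
    exact this ▸ h0
  | succ m ih =>
    obtain ⟨k, -, hk⟩ := Finset.exists_ne_zero_of_sum_ne_zero (hm.trans_ne m.succ_ne_zero)
    have h := hs (Function.update c k (c k - 1)) k (ih _ ?_)
    · have h1 : c k - 1 + 1 = c k := by omega
      simpa [h1] using h
    · have h1 := Finset.sum_update_of_mem (Finset.mem_univ k) c (c k - 1)
      have h2 := Finset.sum_update_of_mem (Finset.mem_univ k) c (c k)
      rw [Function.update_eq_self] at h2
      omega

theorem exists_card_le_of_fockProd_ne_zero {p : ℕ} (α : Fin p → List Bool) (c : Fin p → ℕ) :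
    ∃ K : ℕ, ∀ n S, fockProd n α c S ≠ 0 → S.card ≤ K := by
  induction c using update_succ_induction with
  | h0 =>
    refine ⟨0, fun n S hS => ?_⟩
    rw [fockProd_zero] at hS
    simp only [vac, ne_eq, ite_eq_right_iff, Classical.not_imp] at hS
    simp [hS.1]
  | hs c k ih =>
    obtain ⟨K, hK⟩ := ih
    refine ⟨K + (α k).length, fun n S hS => ?_⟩
    rw [fockProd_update_succ] at hS
    exact card_le_of_Astar_ne_zero (hK n) S hS

theorem exists_sqNorm_fockProd_le {p : ℕ} {α : Fin p → List Bool} (hα : ∀ j, IsPattern (α j))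
    (c : Fin p → ℕ) : ∃ B : ℕ, ∀ n ≥ 1, sqNorm (fockProd n α c) ≤ B := by
  induction c using update_succ_induction with
  | h0 =>
    refine ⟨1, fun n _ => ?_⟩
    rw [fockProd_zero, sqNorm_vac, Nat.cast_one]
  | hs c k ih =>
    obtain ⟨B, hB⟩ := ih
    obtain ⟨K, hK⟩ := exists_card_le_of_fockProd_ne_zero α c
    refine ⟨(K + (α k).length) * (α k).length * B, fun n hn => ?_⟩
    rw [fockProd_update_succ, Nat.cast_mul]
    refine (sqNorm_Astar_le hn (hα k) (hK n)).trans ?_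
    gcongr
    exact hB n hn

theorem smul_fockProd_update_pred (n : ℕ) {p : ℕ} (α : Fin p → List Bool) (c : Fin p → ℕ)
    (j k : Fin p) :
    (Function.update c k (c k + 1) j : ℂ) • fockProd n α (Function.update
        (Function.update c k (c k + 1)) j (Function.update c k (c k + 1) j - 1)) =
      (c j : ℂ) • Astar n (α k) (fockProd n α (Function.update c j (c j - 1))) +
        if j = k then fockProd n α c else 0 := by
  rw [← fockProd_update_succ]
  by_cases hjk : j = k
  · subst hjk
    rcases Nat.eq_zero_or_pos (c j) with h | h
    · simp only [Function.update_self, Function.update_idem, Nat.add_sub_cancel,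
        Function.update_eq_self]
      simp [h]
    · have h1 : c j - 1 + 1 = c j := by omega
      simp [h1, add_smul]
  · simp [hjk, Ne.symm hjk, Function.update_comm hjk]

theorem exists_sqNorm_Aann_fockProd_sub_le {p : ℕ} {α : Fin p → List Bool}
    (hα : ∀ j, IsPattern (α j)) (hinj : Function.Injective α) (j : Fin p) (c : Fin p → ℕ) :
    ∃ C : ℕ, ∀ n ≥ 1, sqNorm (Aann n (α j) (fockProd n α c) -
      (c j : ℂ) • fockProd n α (Function.update c j (c j - 1))) ≤
        ENNReal.ofReal (C / n) := by
  induction c using update_succ_induction with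
  | h0 =>
    refine ⟨0, fun n _ => ?_⟩
    simp [fockProd_zero, Aann_vac (hα j), sqNorm_zero]
  | hs c k ih =>
    obtain ⟨C, hC⟩ := ih
    obtain ⟨B, hB⟩ := exists_sqNorm_fockProd_le hα c
    obtain ⟨K, hK⟩ := exists_card_le_of_fockProd_ne_zero α c
    obtain ⟨K', hK'⟩ :=
      exists_card_le_of_fockProd_ne_zero α (Function.update c j (c j - 1))
    obtain ⟨D, hD⟩ := isSmallOp_commutator (hα k) (hα j) K
    set M := (max K K' + (α k).length) * (α k).length
    refine ⟨2 * (D * B + M * C), fun n hn => ?_⟩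
    set E := Aann n (α j) (fockProd n α c) -
      (c j : ℂ) • fockProd n α (Function.update c j (c j - 1)) with hE
    have hEK : ∀ S, E S ≠ 0 → S.card ≤ max K K' := by
      intro S hS
      by_contra hlt
      rw [not_le, max_lt_iff] at hlt
      refine hS ?_
      have h1 : Aann n (α j) (fockProd n α c) S = 0 := by
        by_contra h
        exact absurd (card_le_of_Aann_ne_zero (hK n) S h) (by omega)
      have h2 : fockProd n α (Function.update c j (c j - 1)) S = 0 := by
        by_contra h
        exact absurd (hK' n S h) (by omega)
      simp [hE, h1, h2]
    have hsplit : Aann n (α j) (fockProd n α (Function.update c k (c k + 1))) -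
        (Function.update c k (c k + 1) j : ℂ) • fockProd n α (Function.update
          (Function.update c k (c k + 1)) j (Function.update c k (c k + 1) j - 1)) =
        (Aann n (α j) (Astar n (α k) (fockProd n α c)) -
          Astar n (α k) (Aann n (α j) (fockProd n α c)) -
            if α j = α k then fockProd n α c else 0) + Astar n (α k) E := by
      rw [smul_fockProd_update_pred, fockProd_update_succ, hE, Astar_sub, Astar_smul]
      simp only [hinj.eq_iff]
      abel
    rw [hsplit]
    have h2 : (2 : ℝ≥0∞) = ENNReal.ofReal 2 := by simp
    calc _ ≤ 2 * (ENNReal.ofReal (D / n) * B + M * ENNReal.ofReal (C / n)) := by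
          refine (sqNorm_add_le _ _).trans ?_
          gcongr
          · refine (hD n hn _ (hK n)).trans ?_
            gcongr
            exact hB n hn
          · refine (sqNorm_Astar_le hn (hα k) hEK).trans ?_
            gcongr
            exact hC n hn
      _ = _ := by
          rw [← ENNReal.ofReal_natCast, ← ENNReal.ofReal_natCast,
            ← ENNReal.ofReal_mul (by positivity), ← ENNReal.ofReal_mul (by positivity),
            ← ENNReal.ofReal_add (by positivity) (by positivity), h2,
            ← ENNReal.ofReal_mul (by positivity)]
          congr 1
          push_cast
          ring

theorem fock_eq (n : ℕ) {p : ℕ} (α : Fin p → List Bool) (c : Fin p → ℕ) :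
    fock n α c = ((Real.sqrt (∏ j, (c j).factorial : ℕ))⁻¹ : ℂ) • fockProd n α c := by
  funext S
  simp [fock, fockProd]

theorem prod_factorial_update_succ {p : ℕ} (c : Fin p → ℕ) (k : Fin p) :
    ∏ j, (Function.update c k (c k + 1) j).factorial =
      (c k + 1) * ∏ j, (c j).factorial := by
  rw [← Finset.mul_prod_erase _ _ (Finset.mem_univ k),
    ← Finset.mul_prod_erase Finset.univ (fun j => (c j).factorial) (Finset.mem_univ k),
    Function.update_self, Nat.factorial_succ, mul_assoc]
  congr 2
  refine Finset.prod_congr rfl fun j hj => ?_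
  rw [Function.update_of_ne (Finset.ne_of_mem_erase hj)]

theorem Astar_fock (n : ℕ) {p : ℕ} (α : Fin p → List Bool) (c : Fin p → ℕ) (k : Fin p) :
    Astar n (α k) (fock n α c) =
      (Real.sqrt (c k + 1) : ℂ) • fock n α (Function.update c k (c k + 1)) := by
  rw [fock_eq, fock_eq, Astar_smul, fockProd_update_succ, smul_smul,
    prod_factorial_update_succ, Nat.cast_mul, Real.sqrt_mul (Nat.cast_nonneg _)]
  congr 1
  have h : (Real.sqrt (c k + 1) : ℂ) ≠ 0 := by
    rw [Complex.ofReal_ne_zero]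
    positivity
  push_cast
  rw [mul_inv, mul_inv_cancel_left₀ h]

theorem sqrt_smul_fock_update_pred (n : ℕ) {p : ℕ} (α : Fin p → List Bool) (c : Fin p → ℕ)
    (k : Fin p) :
    (Real.sqrt (c k) : ℂ) • fock n α (Function.update c k (c k - 1)) =
      ((Real.sqrt (∏ j, (c j).factorial : ℕ))⁻¹ : ℂ) •
        (c k : ℂ) • fockProd n α (Function.update c k (c k - 1)) := by
  rcases Nat.eq_zero_or_pos (c k) with h | h
  · simp [h]
  have h1 := prod_factorial_update_succ (Function.update c k (c k - 1)) k
  have h2 : c k - 1 + 1 = c k := by omega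
  simp only [Function.update_self, Function.update_idem, h2, Function.update_eq_self] at h1
  rw [fock_eq, smul_smul, smul_smul, h1, Nat.cast_mul, Real.sqrt_mul (Nat.cast_nonneg _)]
  congr 1
  have h3 : (Real.sqrt (c k) : ℂ) ≠ 0 := by
    rw [Complex.ofReal_ne_zero]
    positivity
  have h4 : (c k : ℂ) = Real.sqrt (c k) * Real.sqrt (c k) := by
    rw [← Complex.ofReal_mul, Real.mul_self_sqrt (Nat.cast_nonneg _), Complex.ofReal_natCast]
  rw [h4]
  push_cast
  field_simp

theorem tsum_norm_sq_eq (ψ : Finset ℕ → ℂ) : ∑' S, ‖ψ S‖ ^ 2 = (sqNorm ψ).toReal := by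
  rw [sqNorm, ENNReal.tsum_toReal_eq fun S => ENNReal.ofReal_ne_top]
  exact tsum_congr fun S => (ENNReal.toReal_ofReal (by positivity)).symm

/-- Asymptotically in `n`, the translationally invariant creation and
annihilation operators act on the approximate Fock vectors as bosonic ladder operators:
`A*_β(n)|𝐧;n⟩ = √(n_β+1)|𝐧+δ^β;n⟩ + o(1)` and `A_β(n)|𝐧;n⟩ = √(n_β)|𝐧−δ^β;n⟩ + o(1)`
in norm, where `β = α j₀` and `δ^β` is the counts vector equal to `1` at `β` and `0`
elsewhere. -/
theorem stmt13 (p : ℕ)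
    (α : Fin p → List Bool)
    (hα : ∀ j, (α j).head? = some true ∧ (α j).getLast? = some true)
    (hαinj : Function.Injective α)
    (c : Fin p → ℕ) (j₀ : Fin p) :
    Filter.Tendsto
      (fun n : ℕ => Real.sqrt (∑' S : Finset ℕ,
        ‖Astar n (α j₀) (fock n α c) S -
          (Real.sqrt (c j₀ + 1) : ℂ) *
            fock n α (Function.update c j₀ (c j₀ + 1)) S‖ ^ 2))
      Filter.atTop (nhds 0) ∧
    Filter.Tendsto
      (fun n : ℕ => Real.sqrt (∑' S : Finset ℕ,
        ‖Aann n (α j₀) (fock n α c) S -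
          (Real.sqrt (c j₀) : ℂ) *
            fock n α (Function.update c j₀ (c j₀ - 1)) S‖ ^ 2))
      Filter.atTop (nhds 0) := by
  refine ⟨?_, ?_⟩
  · simp [Astar_fock]
  obtain ⟨C, hC⟩ := exists_sqNorm_Aann_fockProd_sub_le hα hαinj j₀ c
  set a : ℂ := ((Real.sqrt (∏ j, (c j).factorial : ℕ))⁻¹ : ℂ) with ha
  set E : ℕ → Finset ℕ → ℂ := fun n => Aann n (α j₀) (fockProd n α c) -
    (c j₀ : ℂ) • fockProd n α (Function.update c j₀ (c j₀ - 1)) with hE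
  have hsplit : ∀ n S, Aann n (α j₀) (fock n α c) S - (Real.sqrt (c j₀) : ℂ) *
      fock n α (Function.update c j₀ (c j₀ - 1)) S = (a • E n) S := by
    intro n S
    have h := congrFun (sqrt_smul_fock_update_pred n α c j₀) S
    rw [Pi.smul_apply, smul_eq_mul] at h
    rw [h, fock_eq, Aann_smul, hE, smul_sub]
    rfl
  simp only [hsplit, tsum_norm_sq_eq]
  rw [← Real.sqrt_zero]
  refine (Real.continuous_sqrt.tendsto 0).comp ?_
  have hlim : Filter.Tendsto (fun n : ℕ => ‖a‖ ^ 2 * (C / n : ℝ)) Filter.atTop (nhds 0) := by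
    simpa using (tendsto_const_div_atTop_nhds_zero_nat (C : ℝ)).const_mul (‖a‖ ^ 2)
  refine squeeze_zero' (Filter.Eventually.of_forall fun n => ENNReal.toReal_nonneg) ?_ hlim
  filter_upwards [Filter.eventually_ge_atTop 1] with n hn
  refine ENNReal.toReal_le_of_le_ofReal (by positivity) ?_
  rw [sqNorm_smul, ENNReal.ofReal_mul (by positivity)]
  gcongr
  exact hC n hn
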